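/- The sub-level sets Ω_c = {ξ̄ ∈ Ω : E(ξ̄) ≤ c} are bounded for every c ∈ ℝ if and only if the coercivity conditions hold: S^j = Σ_{i=1}^{j} [κ_{i−1}(u_i−u_{i−1}) + d_i] ≥ 0 for all j = 1,…,n, and S_j = Σ_{i=j}^{n} [κ_i(u_{i+1}−u_i) + d_i] ≥ 0 for all j = 1,…,n. -/

import Mathlib

open Real Filter Finset

/-- The rescaled Gaussian cumulative distribution function
`F(ξ) = (1/(2√π)) ∫_{-∞}^{ξ} e^{-s²/4} ds`. -/
noncomputable def F (x : ℝ) : ℝ :=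
  (1 / (2 * Real.sqrt Real.pi)) * ∫ s in Set.Iio x, Real.exp (-s ^ 2 / 4)

/-- The derivative `F'(ξ) = (1/(2√π)) e^{-ξ²/4}`. -/
noncomputable def F' (x : ℝ) : ℝ :=
  (1 / (2 * Real.sqrt Real.pi)) * Real.exp (-x ^ 2 / 4)

/-- The functional
`E(ξ̄) = −Σ_{i=0}^{n} k_i(u_{i+1}−u_i) ln(F(ξ_{i+1}/a_i) − F(ξ_i/a_i)) + Σ_{i=1}^{n} d_i ξ_i²/4`,
with the conventions `ξ₀ = −∞`, `ξ_{n+1} = +∞`, i.e. `F(ξ₀/a₀) = 0`, `F(ξ_{n+1}/a_n) = 1`.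
Here `ξ : ℕ → ℝ`, only the values `ξ 1, …, ξ n` being relevant. -/
noncomputable def E (n : ℕ) (u a k d : ℕ → ℝ) (ξ : ℕ → ℝ) : ℝ :=
  -(∑ i ∈ Finset.range (n + 1), k i * (u (i + 1) - u i) *
      Real.log ((if i = n then 1 else F (ξ (i + 1) / a i)) -
        (if i = 0 then 0 else F (ξ i / a i))))
  + ∑ i ∈ Finset.Icc 1 n, d i * ξ i ^ 2 / 4

/-- Reindexing of a point of `ℝⁿ` as the sequence `ξ_1, …, ξ_n` (paper indexing). -/
noncomputable def toSeq (n : ℕ) (x : EuclideanSpace ℝ (Fin n)) : ℕ → ℝ :=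
  fun i => if h : i - 1 < n then x ⟨i - 1, h⟩ else 0

/-- The left-hand side of the `i`-th equation (`1 ≤ i ≤ n`) of the Stefan system:
`d_i ξ_i/2 + k_i(u_{i+1}−u_i) F'(ξ_i/a_i)/(a_i (F(ξ_{i+1}/a_i) − F(ξ_i/a_i)))
 − k_{i−1}(u_i−u_{i−1}) F'(ξ_i/a_{i−1})/(a_{i−1} (F(ξ_i/a_{i−1}) − F(ξ_{i−1}/a_{i−1})))`,
with the conventions `ξ₀ = −∞` (so `F(ξ₀/a₀) = 0`) and `ξ_{n+1} = +∞` (so `F(ξ_{n+1}/a_n) = 1`). -/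
noncomputable def stefanLHS (n : ℕ) (u a k d : ℕ → ℝ) (ξ : ℕ → ℝ) (i : ℕ) : ℝ :=
  d i * ξ i / 2
  + k i * (u (i + 1) - u i) * F' (ξ i / a i) /
      (a i * ((if i = n then 1 else F (ξ (i + 1) / a i)) - F (ξ i / a i)))
  - k (i - 1) * (u i - u (i - 1)) * F' (ξ i / a (i - 1)) /
      (a (i - 1) * (F (ξ i / a (i - 1)) - (if i = 1 then 0 else F (ξ (i - 1) / a (i - 1)))))

theorem integrable_exp_neg_sq_div_four :
    MeasureTheory.Integrable (fun s : ℝ => Real.exp (-s ^ 2 / 4)) := by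
  have h := integrable_exp_neg_mul_sq (b := 1 / 4) (by norm_num)
  refine h.congr (Eventually.of_forall fun s => ?_)
  simp only
  congr 1
  ring

theorem integral_exp_neg_sq_div_four :
    ∫ s : ℝ, Real.exp (-s ^ 2 / 4) = 2 * Real.sqrt Real.pi := by
  have h := integral_gaussian (1 / 4)
  have h2 : Real.pi / (1 / 4) = 2 ^ 2 * Real.pi := by ring
  rw [h2, Real.sqrt_mul (by norm_num), Real.sqrt_sq (by norm_num)] at h
  rw [← h]
  congr 1
  ext s
  congr 1
  ring

theorem F_nonneg (x : ℝ) : 0 ≤ F x :=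
  mul_nonneg (by positivity) (MeasureTheory.integral_nonneg fun s => (Real.exp_pos _).le)

theorem F_neg (x : ℝ) : F (-x) = 1 - F x := by
  have h1 := MeasureTheory.integral_add_compl (measurableSet_Iio (a := x))
    integrable_exp_neg_sq_div_four
  rw [integral_exp_neg_sq_div_four, Set.compl_Iio,
    MeasureTheory.integral_Ici_eq_integral_Ioi] at h1
  have h2 := integral_comp_neg_Ioi (-(-x)) (fun s => Real.exp (-s ^ 2 / 4))
  simp only [neg_neg, neg_sq] at h2
  rw [h2, MeasureTheory.integral_Iic_eq_integral_Iio] at h1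
  have hpi : 0 < Real.sqrt Real.pi := Real.sqrt_pos.2 Real.pi_pos
  have h3 : 1 = 1 / (2 * Real.sqrt Real.pi) * (2 * Real.sqrt Real.pi) := by field_simp
  unfold F
  nth_rewrite 2 [h3]
  rw [← h1]
  ring

theorem F_sub_eq_intervalIntegral (x y : ℝ) :
    F y - F x = 1 / (2 * Real.sqrt Real.pi) * ∫ s in x..y, Real.exp (-s ^ 2 / 4) := by
  unfold F
  rw [← mul_sub, ← MeasureTheory.integral_Iic_eq_integral_Iio,
    ← MeasureTheory.integral_Iic_eq_integral_Iio,
    intervalIntegral.integral_Iic_sub_Iic integrable_exp_neg_sq_div_four.integrableOn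
      integrable_exp_neg_sq_div_four.integrableOn]

theorem le_F_sub {x y B : ℝ} (hxy : x ≤ y) (hx : |x| ≤ B) (hy : |y| ≤ B) :
    1 / (2 * Real.sqrt Real.pi) * ((y - x) * Real.exp (-B ^ 2 / 4)) ≤ F y - F x := by
  rw [F_sub_eq_intervalIntegral]
  refine mul_le_mul_of_nonneg_left ?_ (by positivity)
  have h := intervalIntegral.integral_mono_on (μ := MeasureTheory.volume)
    (f := fun _ => Real.exp (-B ^ 2 / 4))
    (g := fun s => Real.exp (-s ^ 2 / 4)) hxy (by simp)
    integrable_exp_neg_sq_div_four.intervalIntegrable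
    (fun s hs => by
      rw [abs_le] at hx hy
      have : s ^ 2 ≤ B ^ 2 := sq_le_sq' (by linarith [hs.1]) (by linarith [hs.2])
      exact Real.exp_le_exp.2 (by linarith))
  simpa using h

theorem F_strictMono : StrictMono F := by
  intro x y hxy
  have h := le_F_sub hxy.le (le_max_left |x| |y|) (le_max_right |x| |y|)
  have hpi : 0 < Real.sqrt Real.pi := Real.sqrt_pos.2 Real.pi_pos
  have h2 : 0 < y - x := sub_pos.2 hxy
  have : 0 < 1 / (2 * Real.sqrt Real.pi) * ((y - x) * Real.exp (-(max |x| |y|) ^ 2 / 4)) := by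
    positivity
  linarith

theorem F_pos (x : ℝ) : 0 < F x :=
  (F_nonneg (x - 1)).trans_lt (F_strictMono (by linarith))

theorem F_lt_one (x : ℝ) : F x < 1 := by
  have := F_pos (-x)
  rw [F_neg] at this
  linarith

/-- Gaussian tail bound with the sharp polynomial prefactor. -/
theorem F_neg_le {t : ℝ} (ht : 0 ≤ t) :
    F (-t) ≤ Real.exp (1 - t ^ 2 / 4) / (1 + t / 2) := by
  have hb : 0 < 1 + t / 2 := by positivity
  have hint : MeasureTheory.IntegrableOn
      (fun s => Real.exp (1 - t ^ 2 / 4 + (1 + t / 2) * t) * Real.exp ((1 + t / 2) * s))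
      (Set.Iio (-t)) :=
    (((integrableOn_exp_mul_Iic hb (-t)).mono_set Set.Iio_subset_Iic_self).const_mul _)
  have h1 : ∫ s in Set.Iio (-t), Real.exp (-s ^ 2 / 4) ≤
      ∫ s in Set.Iio (-t),
        Real.exp (1 - t ^ 2 / 4 + (1 + t / 2) * t) * Real.exp ((1 + t / 2) * s) := by
    refine MeasureTheory.integral_mono integrable_exp_neg_sq_div_four.integrableOn hint
      fun s => ?_
    simp only
    rw [← Real.exp_add]
    exact Real.exp_le_exp.2 (by nlinarith [sq_nonneg (s + t + 2)])
  rw [MeasureTheory.integral_const_mul,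
    ← MeasureTheory.integral_Iic_eq_integral_Iio (f := fun s => Real.exp ((1 + t / 2) * s)),
    integral_exp_mul_Iic hb, ← mul_div_assoc, ← Real.exp_add] at h1
  have h2 : 1 - t ^ 2 / 4 + (1 + t / 2) * t + (1 + t / 2) * -t = 1 - t ^ 2 / 4 := by ring
  rw [h2] at h1
  have hc : 1 / (2 * Real.sqrt Real.pi) ≤ 1 := by
    have : 1 ≤ Real.sqrt Real.pi := Real.one_le_sqrt.2 (by linarith [Real.pi_gt_three])
    rw [div_le_one (by positivity)]
    linarith
  have h3 : 0 ≤ ∫ s in Set.Iio (-t), Real.exp (-s ^ 2 / 4) :=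
    MeasureTheory.integral_nonneg fun s => (Real.exp_pos _).le
  unfold F
  exact (mul_le_of_le_one_left h3 hc).trans h1

/-- A lower bound, up to an additive constant, for `-log (F (-t / a))`. -/
noncomputable def tailCost (a t : ℝ) : ℝ := t ^ 2 / (4 * a ^ 2) + Real.log (1 + t / (2 * a))

@[simp] theorem tailCost_zero (a : ℝ) : tailCost a 0 = 0 := by simp [tailCost]

theorem tailCost_le_neg_log_F {a t : ℝ} (ha : 0 < a) (ht : 0 ≤ t) :
    tailCost a t - 1 ≤ -Real.log (F (-t / a)) := by
  have hta : 0 ≤ t / a := by positivity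
  have h := Real.log_le_log (F_pos _) (F_neg_le hta)
  rw [Real.log_div (Real.exp_pos _).ne' (by positivity), Real.log_exp] at h
  have h1 : t / a / 2 = t / (2 * a) := by field_simp
  have h2 : (t / a) ^ 2 / 4 = t ^ 2 / (4 * a ^ 2) := by field_simp
  rw [h1, h2] at h
  rw [neg_div]
  unfold tailCost
  linarith

theorem tailCost_max_le_neg_log_of_le_F {a y D : ℝ} (ha : 0 < a) (hD : 0 < D)
    (h1 : D ≤ 1) (h : D ≤ F (y / a)) : tailCost a (max (-y) 0) - 1 ≤ -Real.log D := by
  rcases le_total 0 y with hy | hy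
  · rw [max_eq_right (by linarith), tailCost_zero]
    linarith [Real.log_nonpos hD.le h1]
  · rw [max_eq_left (by linarith)]
    have := tailCost_le_neg_log_F (t := -y) ha (by linarith)
    rw [neg_neg] at this
    linarith [Real.log_le_log hD h]

theorem tailCost_max_le_neg_log_of_le_one_sub_F {a x D : ℝ} (ha : 0 < a) (hD : 0 < D)
    (h1 : D ≤ 1) (h : D ≤ 1 - F (x / a)) : tailCost a (max x 0) - 1 ≤ -Real.log D := by
  rw [← F_neg, ← neg_div] at h
  simpa using tailCost_max_le_neg_log_of_le_F ha hD h1 h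

theorem tailCost_add_tailCost_le {a x y : ℝ} (ha : 0 < a) (hxy : x < y) :
    tailCost a (max (-y) 0) + tailCost a (max x 0) - 1 ≤
      -Real.log (F (y / a) - F (x / a)) := by
  have hD : 0 < F (y / a) - F (x / a) := sub_pos.2 (F_strictMono (by gcongr))
  have h1 : F (y / a) - F (x / a) ≤ 1 := by linarith [F_lt_one (y / a), F_pos (x / a)]
  have hA := tailCost_max_le_neg_log_of_le_F (y := y) ha hD h1 (by linarith [F_pos (x / a)])
  have hB := tailCost_max_le_neg_log_of_le_one_sub_F (x := x) ha hD h1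
    (by linarith [F_lt_one (y / a)])
  rcases le_total 0 y with hy | hy
  · rw [max_eq_right (a := -y) (by linarith), tailCost_zero]
    linarith
  · rw [max_eq_right (a := x) (by linarith), tailCost_zero]
    linarith

theorem mul_sum_Icc_le_sum_mul_of_antitone {s m : ℕ → ℝ} {n : ℕ} (hn : 1 ≤ n)
    (hm : ∀ i, 1 ≤ i → i < n → m (i + 1) ≤ m i)
    (hs : ∀ j, 1 ≤ j → j ≤ n → 0 ≤ ∑ i ∈ Finset.Icc 1 j, s i) :
    m n * ∑ i ∈ Finset.Icc 1 n, s i ≤ ∑ i ∈ Finset.Icc 1 n, s i * m i := by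
  induction n, hn using Nat.le_induction with
  | base => simp [mul_comm]
  | succ n hn ih =>
    have h := ih (fun i h1 h2 => hm i h1 (by omega)) (fun j h1 h2 => hs j h1 (by omega))
    rw [Finset.sum_Icc_succ_top (by omega), Finset.sum_Icc_succ_top (by omega)]
    nlinarith [hs n hn (by omega), hm n hn (by omega)]

theorem sum_Icc_mul_nonneg_of_antitone {s m : ℕ → ℝ} {n : ℕ}
    (hm0 : ∀ i, 0 ≤ m i) (hm : ∀ i, 1 ≤ i → i < n → m (i + 1) ≤ m i)
    (hs : ∀ j, 1 ≤ j → j ≤ n → 0 ≤ ∑ i ∈ Finset.Icc 1 j, s i) :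
    0 ≤ ∑ i ∈ Finset.Icc 1 n, s i * m i := by
  rcases Nat.eq_zero_or_pos n with rfl | hn
  · simp
  · exact (mul_nonneg (hm0 n) (hs n hn le_rfl)).trans (mul_sum_Icc_le_sum_mul_of_antitone hn hm hs)

theorem sum_Icc_reflect_tail (f : ℕ → ℝ) {j n : ℕ} (hjn : j ≤ n) :
    ∑ i ∈ Finset.Icc 1 j, f (n + 1 - i) = ∑ i ∈ Finset.Icc (n + 1 - j) n, f i := by
  refine Finset.sum_nbij' (fun i => n + 1 - i) (fun i => n + 1 - i) ?_ ?_ ?_ ?_ ?_ <;>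
    simp only [Finset.mem_Icc] <;> intros
  any_goals omega
  trivial

theorem sum_Icc_mul_nonneg_of_monotone {s q : ℕ → ℝ} {n : ℕ}
    (hq0 : ∀ i, 0 ≤ q i) (hq : ∀ i, 1 ≤ i → i < n → q i ≤ q (i + 1))
    (hs : ∀ j, 1 ≤ j → j ≤ n → 0 ≤ ∑ i ∈ Finset.Icc j n, s i) :
    0 ≤ ∑ i ∈ Finset.Icc 1 n, s i * q i := by
  have h := sum_Icc_mul_nonneg_of_antitone (s := fun i => s (n + 1 - i))
    (m := fun i => q (n + 1 - i)) (n := n) (fun i => hq0 _)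
    (fun i h1 h2 => by
      have := hq (n + 1 - (i + 1)) (by omega) (by omega)
      rwa [show n + 1 - (i + 1) + 1 = n + 1 - i by omega] at this)
    (fun j h1 h2 => by
      rw [sum_Icc_reflect_tail s h2]
      exact hs _ (by omega) (by omega))
  rwa [sum_Icc_reflect_tail (fun i => s i * q i) le_rfl,
    show n + 1 - n = 1 by omega] at h

theorem sum_range_succ_ite_eq_sum_Icc (f : ℕ → ℝ) (n : ℕ) :
    ∑ i ∈ Finset.range (n + 1), (if i = n then 0 else f (i + 1)) =
      ∑ i ∈ Finset.Icc 1 n, f i := by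
  rw [Finset.sum_range_succ, if_pos rfl, add_zero, Finset.range_eq_Ico,
    ← Finset.Ico_add_one_right_eq_Icc, Finset.sum_Ico_eq_sum_range, Finset.sum_Ico_eq_sum_range]
  refine Finset.sum_congr (by simp) fun i hi => ?_
  rw [Finset.mem_range] at hi
  rw [if_neg (by omega)]
  congr 1
  omega

theorem sum_range_succ_ite_zero_eq_sum_Icc (f : ℕ → ℝ) (n : ℕ) :
    ∑ i ∈ Finset.range (n + 1), (if i = 0 then 0 else f i) = ∑ i ∈ Finset.Icc 1 n, f i := by
  rw [Finset.sum_range_succ', if_pos rfl, add_zero,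
    ← Finset.Ico_add_one_right_eq_Icc, Finset.sum_Ico_eq_sum_range]
  refine Finset.sum_congr (by simp) fun i hi => ?_
  rw [if_neg (by omega), add_comm]

theorem E_congr {n : ℕ} {u a k d ξ η : ℕ → ℝ} (h : ∀ i, 1 ≤ i → i ≤ n → ξ i = η i) :
    E n u a k d ξ = E n u a k d η := by
  unfold E
  congr 1
  · congr 1
    refine Finset.sum_congr rfl fun i hi => ?_
    rw [Finset.mem_range] at hi
    congr 3
    · split_ifs with h1
      · rfl
      · rw [h (i + 1) (by omega) (by omega)]
    · split_ifs with h1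
      · rfl
      · rw [h i (by omega) (by omega)]
  · refine Finset.sum_congr rfl fun i hi => ?_
    rw [Finset.mem_Icc] at hi
    rw [h i hi.1 hi.2]

/-- Lower bound for the logarithm of the `i`-th phase entering `E`, in terms of both endpoints. -/
theorem tailCost_le_neg_log_phase {n : ℕ} (hn : 1 ≤ n) {a ξ : ℕ → ℝ} (ha : ∀ i ≤ n, 0 < a i)
    (hξ : ∀ i, 1 ≤ i → i < n → ξ i < ξ (i + 1)) {i : ℕ} (hi : i ≤ n) :
    (if i = n then 0 else tailCost (a i) (max (-ξ (i + 1)) 0)) +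
        (if i = 0 then 0 else tailCost (a i) (max (ξ i) 0)) - 1 ≤
      -Real.log ((if i = n then 1 else F (ξ (i + 1) / a i)) -
        (if i = 0 then 0 else F (ξ i / a i))) := by
  rcases eq_or_ne i n with rfl | hin
  · have h0 : i ≠ 0 := by omega
    simp only [if_true, if_neg h0, zero_add]
    exact tailCost_max_le_neg_log_of_le_one_sub_F (ha i le_rfl)
      (by linarith [F_lt_one (ξ i / a i)]) (by linarith [F_pos (ξ i / a i)]) le_rfl
  · rcases eq_or_ne i 0 with rfl | h0
    · simp only [if_neg hin, if_true, add_zero, sub_zero]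
      exact tailCost_max_le_neg_log_of_le_F (ha 0 hi) (F_pos _) (F_lt_one _).le le_rfl
    · simp only [if_neg hin, if_neg h0]
      exact tailCost_add_tailCost_le (ha i hi) (hξ i (by omega) (by omega))

theorem sum_log_le_E {n : ℕ} (hn : 1 ≤ n) {u a k d ξ : ℕ → ℝ}
    (hu : ∀ i ≤ n, u i < u (i + 1)) (ha : ∀ i ≤ n, 0 < a i) (hk : ∀ i ≤ n, 0 < k i)
    (hξ : ∀ i, 1 ≤ i → i < n → ξ i < ξ (i + 1))
    (hS : ∀ j, 1 ≤ j → j ≤ n →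
      0 ≤ ∑ i ∈ Finset.Icc 1 j, (k (i - 1) / a (i - 1) ^ 2 * (u i - u (i - 1)) + d i))
    (hS' : ∀ j, 1 ≤ j → j ≤ n →
      0 ≤ ∑ i ∈ Finset.Icc j n, (k i / a i ^ 2 * (u (i + 1) - u i) + d i)) :
    ∑ i ∈ Finset.Icc 1 n,
        (k (i - 1) * (u i - u (i - 1)) * Real.log (1 + max (-ξ i) 0 / (2 * a (i - 1))) +
          k i * (u (i + 1) - u i) * Real.log (1 + max (ξ i) 0 / (2 * a i))) -
      ∑ i ∈ Finset.range (n + 1), k i * (u (i + 1) - u i) ≤ E n u a k d ξ := by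
  have hm := sum_Icc_mul_nonneg_of_antitone (m := fun i => max (-ξ i) 0 ^ 2 / 4)
    (fun i => by positivity)
    (fun i h1 h2 => by
      have := hξ i h1 h2
      gcongr) hS
  have hq := sum_Icc_mul_nonneg_of_monotone (q := fun i => max (ξ i) 0 ^ 2 / 4)
    (fun i => by positivity)
    (fun i h1 h2 => by
      have := hξ i h1 h2
      gcongr) hS'
  have hlog : ∑ i ∈ Finset.range (n + 1),
      ((if i = n then 0 else
          k (i + 1 - 1) * (u (i + 1) - u (i + 1 - 1)) *
            tailCost (a (i + 1 - 1)) (max (-ξ (i + 1)) 0)) +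
        (if i = 0 then 0 else k i * (u (i + 1) - u i) * tailCost (a i) (max (ξ i) 0)) -
        k i * (u (i + 1) - u i)) ≤
      ∑ i ∈ Finset.range (n + 1), -(k i * (u (i + 1) - u i) *
        Real.log ((if i = n then 1 else F (ξ (i + 1) / a i)) -
          (if i = 0 then 0 else F (ξ i / a i)))) := by
    refine Finset.sum_le_sum fun i hi => ?_
    have hi' : i ≤ n := Nat.lt_succ_iff.1 (Finset.mem_range.1 hi)
    have hw : 0 < k i * (u (i + 1) - u i) := mul_pos (hk i hi') (sub_pos.2 (hu i hi'))
    have h := mul_le_mul_of_nonneg_left (tailCost_le_neg_log_phase hn ha hξ hi') hw.le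
    rw [mul_sub, mul_add, mul_ite, mul_ite, mul_zero, mul_one, mul_neg] at h
    exact h
  rw [Finset.sum_sub_distrib, Finset.sum_add_distrib,
    sum_range_succ_ite_eq_sum_Icc (fun i => k (i - 1) * (u i - u (i - 1)) *
            tailCost (a (i - 1)) (max (-ξ i) 0)),
    sum_range_succ_ite_zero_eq_sum_Icc
      (fun i => k i * (u (i + 1) - u i) * tailCost (a i) (max (ξ i) 0)),
    Finset.sum_neg_distrib, ← Finset.sum_add_distrib] at hlog
  have hsq : ∀ x : ℝ, x ^ 2 = max (-x) 0 ^ 2 + max x 0 ^ 2 := by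
    intro x
    rcases le_total 0 x with hx | hx
    · simp [hx]
    · simp [hx]
  have hterm : ∑ i ∈ Finset.Icc 1 n,
        (k (i - 1) * (u i - u (i - 1)) * Real.log (1 + max (-ξ i) 0 / (2 * a (i - 1))) +
          k i * (u (i + 1) - u i) * Real.log (1 + max (ξ i) 0 / (2 * a i))) +
      (∑ i ∈ Finset.Icc 1 n, (k (i - 1) / a (i - 1) ^ 2 * (u i - u (i - 1)) + d i) *
          (max (-ξ i) 0 ^ 2 / 4) +
        ∑ i ∈ Finset.Icc 1 n, (k i / a i ^ 2 * (u (i + 1) - u i) + d i) *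
          (max (ξ i) 0 ^ 2 / 4)) =
      ∑ i ∈ Finset.Icc 1 n,
        (k (i - 1) * (u i - u (i - 1)) * tailCost (a (i - 1)) (max (-ξ i) 0) +
          k i * (u (i + 1) - u i) * tailCost (a i) (max (ξ i) 0)) +
      ∑ i ∈ Finset.Icc 1 n, d i * ξ i ^ 2 / 4 := by
    simp only [← Finset.sum_add_distrib]
    refine Finset.sum_congr rfl fun i hi => ?_
    rw [hsq (ξ i)]
    unfold tailCost
    ring
  unfold E
  linarith

theorem le_of_mul_log_le {w a t K : ℝ} (hw : 0 < w) (ha : 0 < a) (ht : 0 ≤ t)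
    (h : w * Real.log (1 + t / (2 * a)) ≤ K) : t ≤ 2 * a * Real.exp (K / w) := by
  have h1 : Real.log (1 + t / (2 * a)) ≤ K / w := by
    rw [le_div_iff₀ hw]
    linarith
  have h2 : 1 + t / (2 * a) ≤ Real.exp (K / w) :=
    (Real.log_le_iff_le_exp (by positivity)).1 h1
  have h3 : t / (2 * a) ≤ Real.exp (K / w) := by linarith
  rw [div_le_iff₀ (by positivity)] at h3
  linarith

theorem isBounded_sublevel_of_coercive {n : ℕ} (hn : 1 ≤ n) {u a k d : ℕ → ℝ}
    (hu : ∀ i ≤ n, u i < u (i + 1)) (ha : ∀ i ≤ n, 0 < a i) (hk : ∀ i ≤ n, 0 < k i)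
    (hS : ∀ j, 1 ≤ j → j ≤ n →
      0 ≤ ∑ i ∈ Finset.Icc 1 j, (k (i - 1) / a (i - 1) ^ 2 * (u i - u (i - 1)) + d i))
    (hS' : ∀ j, 1 ≤ j → j ≤ n →
      0 ≤ ∑ i ∈ Finset.Icc j n, (k i / a i ^ 2 * (u (i + 1) - u i) + d i)) (c : ℝ) :
    Bornology.IsBounded {x : EuclideanSpace ℝ (Fin n) |
        (∀ i j : Fin n, i < j → x i < x j) ∧ E n u a k d (toSeq n x) ≤ c} := by
  set w : ℕ → ℝ := fun i => k i * (u (i + 1) - u i) with hw_def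
  have hw : ∀ i ≤ n, 0 < w i := fun i hi => mul_pos (hk i hi) (sub_pos.2 (hu i hi))
  set K := c + ∑ i ∈ Finset.range (n + 1), w i with hK
  set B : ℕ → ℝ := fun i =>
    2 * a (i - 1) * Real.exp (K / w (i - 1)) + 2 * a i * Real.exp (K / w i) with hB
  rw [isBounded_iff_forall_norm_le]
  refine ⟨Real.sqrt (∑ i : Fin n, B (i + 1) ^ 2), fun x ⟨hx, hE⟩ => ?_⟩
  have hmono : ∀ i, 1 ≤ i → i < n → toSeq n x i < toSeq n x (i + 1) := by
    intro i h1 h2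
    unfold toSeq
    rw [dif_pos (by omega), dif_pos (by omega)]
    exact hx _ _ (Fin.mk_lt_mk.2 (by omega))
  have hsum := (sum_log_le_E hn hu ha hk hmono hS hS').trans hE
  have hnonneg : ∀ (t b v : ℝ), 0 < v → 0 < b → 0 ≤ t → 0 ≤ v * Real.log (1 + t / (2 * b)) := by
    intro t b v hv hb ht
    have : 0 ≤ t / (2 * b) := by positivity
    exact mul_nonneg hv.le (Real.log_nonneg (by linarith))
  have hw' : ∀ i, 1 ≤ i → i ≤ n → k (i - 1) * (u i - u (i - 1)) = w (i - 1) := by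
    intro i h1 h2
    simp only [hw_def]
    rw [Nat.sub_add_cancel h1]
  have hfst : ∀ i, 1 ≤ i → i ≤ n →
      0 ≤ k (i - 1) * (u i - u (i - 1)) *
        Real.log (1 + max (-toSeq n x i) 0 / (2 * a (i - 1))) := by
    intro i h1 h2
    rw [hw' i h1 h2]
    exact hnonneg _ _ _ (hw _ (by omega)) (ha _ (by omega)) (le_max_right _ _)
  have hsnd : ∀ i, 1 ≤ i → i ≤ n →
      0 ≤ k i * (u (i + 1) - u i) * Real.log (1 + max (toSeq n x i) 0 / (2 * a i)) :=
    fun i h1 h2 => hnonneg _ _ _ (hw _ h2) (ha _ h2) (le_max_right _ _)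
  have hbound : ∀ i, 1 ≤ i → i ≤ n → |toSeq n x i| ≤ B i := by
    intro i h1 h2
    have hle := Finset.single_le_sum (f := fun i =>
        (k (i - 1) * (u i - u (i - 1)) *
            Real.log (1 + max (-toSeq n x i) 0 / (2 * a (i - 1))) +
          k i * (u (i + 1) - u i) * Real.log (1 + max (toSeq n x i) 0 / (2 * a i))))
      (fun j hj => by
        rw [Finset.mem_Icc] at hj
        exact add_nonneg (hfst j hj.1 hj.2) (hsnd j hj.1 hj.2)) (Finset.mem_Icc.2 ⟨h1, h2⟩)
    have hl := le_of_mul_log_le (w := w (i - 1)) (K := K) (hw _ (by omega))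
      (ha (i - 1) (by omega))
      (le_max_right (-toSeq n x i) 0) (by
        rw [← hw' i h1 h2]
        linarith [hsnd i h1 h2])
    have hr := le_of_mul_log_le (w := w i) (K := K) (hw _ h2) (ha i h2)
      (le_max_right (toSeq n x i) 0) (by
        simp only [hw_def] at hK ⊢
        linarith [hfst i h1 h2])
    have hl0 := le_max_right (-toSeq n x i) 0
    have hr0 := le_max_right (toSeq n x i) 0
    rw [abs_le]
    constructor
    · linarith [le_max_left (-toSeq n x i) 0]
    · linarith [le_max_left (toSeq n x i) 0]
  rw [EuclideanSpace.norm_eq]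
  refine Real.sqrt_le_sqrt (Finset.sum_le_sum fun i _ => ?_)
  have h := hbound (i + 1) (by omega) (by omega)
  unfold toSeq at h
  rw [dif_pos (by omega)] at h
  simp only [Nat.add_sub_cancel, Fin.eta] at h
  rw [Real.norm_eq_abs]
  gcongr

/-- `-log` of the `F`-mass of an interval of fixed length translated to distance `g * R`
grows at most quadratically, with the expected leading coefficient. -/
theorem exists_neg_log_F_sub_le {a : ℝ} (ha : 0 < a) (b g : ℝ) :
    ∃ C, ∀ R, 1 ≤ R → ∀ D, F ((b + 1 + g * R) / a) - F ((b + g * R) / a) ≤ D →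
      -Real.log D ≤ g ^ 2 / a ^ 2 * R ^ 2 / 4 + C * R := by
  have hpi : 0 < Real.sqrt Real.pi := Real.sqrt_pos.2 Real.pi_pos
  set p : ℝ := 1 / (2 * Real.sqrt Real.pi) * (1 / a) with hp
  have hp0 : 0 < p := by positivity
  refine ⟨((|b| + 1) ^ 2 + 2 * (|b| + 1) * |g|) / (4 * a ^ 2) + |Real.log p|,
    fun R hR D hD => ?_⟩
  have hR0 : 0 < R := by linarith
  have habs : |g * R| = |g| * R := by rw [abs_mul, abs_of_pos hR0]
  have hx : |(b + g * R) / a| ≤ (|b| + 1 + |g| * R) / a := by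
    rw [abs_div, abs_of_pos ha, ← habs]
    gcongr
    linarith [abs_add_le b (g * R)]
  have hy : |(b + 1 + g * R) / a| ≤ (|b| + 1 + |g| * R) / a := by
    rw [abs_div, abs_of_pos ha, ← habs]
    gcongr
    have := abs_add_le b 1
    rw [abs_one] at this
    linarith [abs_add_le (b + 1) (g * R)]
  have h := (le_F_sub (by gcongr; linarith) hx hy).trans hD
  have heq : (b + 1 + g * R) / a - (b + g * R) / a = 1 / a := by ring
  rw [heq, ← mul_assoc] at h
  have hlog := Real.log_le_log (by positivity) h
  rw [Real.log_mul hp0.ne' (Real.exp_pos _).ne', Real.log_exp] at hlog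
  have hsq : ((|b| + 1 + |g| * R) / a) ^ 2 / 4 = g ^ 2 / a ^ 2 * R ^ 2 / 4 +
      ((|b| + 1) ^ 2 + 2 * (|b| + 1) * |g| * R) / (4 * a ^ 2) := by
    rw [← sq_abs g]
    field_simp
    ring
  have hlin : ((|b| + 1) ^ 2 + 2 * (|b| + 1) * |g| * R) / (4 * a ^ 2) ≤
      ((|b| + 1) ^ 2 + 2 * (|b| + 1) * |g|) / (4 * a ^ 2) * R := by
    rw [div_mul_eq_mul_div]
    gcongr
    nlinarith [sq_nonneg (|b| + 1)]
  have hpR : |Real.log p| ≤ |Real.log p| * R := le_mul_of_one_le_right (abs_nonneg _) hR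
  have := neg_abs_le (Real.log p)
  rw [neg_div] at hlog
  linarith

theorem exists_sum_le_quadratic {s : Finset ℕ} {f : ℕ → ℝ → ℝ} {α : ℕ → ℝ}
    (h : ∀ i ∈ s, ∃ C, ∀ R, 1 ≤ R → f i R ≤ α i * R ^ 2 / 4 + C * R) :
    ∃ C, ∀ R, 1 ≤ R → ∑ i ∈ s, f i R ≤ (∑ i ∈ s, α i) * R ^ 2 / 4 + C * R := by
  choose! C hC using h
  refine ⟨∑ i ∈ s, C i, fun R hR => ?_⟩
  rw [Finset.sum_mul, Finset.sum_mul, Finset.sum_div, ← Finset.sum_add_distrib]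
  exact Finset.sum_le_sum fun i hi => hC i hi R hR

theorem exists_E_le_quadratic {n : ℕ} {u a k d e g : ℕ → ℝ}
    (hu : ∀ i ≤ n, u i < u (i + 1)) (ha : ∀ i ≤ n, 0 < a i) (hk : ∀ i ≤ n, 0 < k i)
    (heg : ∀ i, e i ≤ g i) (hge : ∀ i, g i ≤ e (i + 1)) :
    ∃ C, ∀ R, 1 ≤ R → E n u a k d (fun i => i + e i * R) ≤
      (∑ i ∈ Finset.range (n + 1), k i / a i ^ 2 * (u (i + 1) - u i) * g i ^ 2 +
        ∑ i ∈ Finset.Icc 1 n, d i * e i ^ 2) * R ^ 2 / 4 + C * R := by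
  obtain ⟨C₁, hC₁⟩ := exists_sum_le_quadratic (s := Finset.range (n + 1))
    (f := fun i R => -(k i * (u (i + 1) - u i) *
      Real.log ((if i = n then 1 else F (((i + 1 : ℕ) + e (i + 1) * R) / a i)) -
        (if i = 0 then 0 else F ((i + e i * R) / a i)))))
    (α := fun i => k i / a i ^ 2 * (u (i + 1) - u i) * g i ^ 2) (fun i hi => by
      have hi' : i ≤ n := Nat.lt_succ_iff.1 (Finset.mem_range.1 hi)
      have hw : 0 < k i * (u (i + 1) - u i) := mul_pos (hk i hi') (sub_pos.2 (hu i hi'))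
      have hai := ha i hi'
      obtain ⟨C, hC⟩ := exists_neg_log_F_sub_le hai i (g i)
      refine ⟨k i * (u (i + 1) - u i) * C, fun R hR => ?_⟩
      have h := mul_le_mul_of_nonneg_left (hC R hR
        ((if i = n then 1 else F (((i + 1 : ℕ) + e (i + 1) * R) / a i)) -
          (if i = 0 then 0 else F ((i + e i * R) / a i))) ?_) hw.le
      · refine le_trans (le_of_eq ?_) (h.trans (le_of_eq ?_))
        · ring
        · ring
      · refine sub_le_sub ?_ ?_
        · split_ifs
          · exact (F_lt_one _).le
          · refine F_strictMono.monotone ?_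
            push_cast
            have := hge i
            gcongr
        · split_ifs
          · exact F_nonneg _
          · refine F_strictMono.monotone ?_
            have := heg i
            gcongr)
  obtain ⟨C₂, hC₂⟩ := exists_sum_le_quadratic (s := Finset.Icc 1 n)
    (f := fun i R => d i * (i + e i * R) ^ 2 / 4) (α := fun i => d i * e i ^ 2) (fun i hi => by
      refine ⟨|d i * i ^ 2 / 4| + d i * i * e i / 2, fun R hR => ?_⟩
      have h1 := le_mul_of_one_le_right (abs_nonneg (d i * i ^ 2 / 4)) hR
      have h2 := le_abs_self (d i * i ^ 2 / 4)
      nlinarith)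
  refine ⟨C₁ + C₂, fun R hR => ?_⟩
  have h1 := hC₁ R hR
  have h2 := hC₂ R hR
  simp only [Finset.sum_neg_distrib] at h1 h2
  unfold E
  linarith

theorem nonneg_of_isBounded_sublevel {n : ℕ} {u a k d e g : ℕ → ℝ}
    (hu : ∀ i ≤ n, u i < u (i + 1)) (ha : ∀ i ≤ n, 0 < a i) (hk : ∀ i ≤ n, 0 < k i)
    (hbdd : Bornology.IsBounded {x : EuclideanSpace ℝ (Fin n) |
        (∀ i j : Fin n, i < j → x i < x j) ∧ E n u a k d (toSeq n x) ≤ 0})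
    (heg : ∀ i, e i ≤ g i) (hge : ∀ i, g i ≤ e (i + 1)) {j : ℕ} (hj : 1 ≤ j) (hjn : j ≤ n)
    (hej : |e j| = 1) :
    0 ≤ ∑ i ∈ Finset.range (n + 1), k i / a i ^ 2 * (u (i + 1) - u i) * g i ^ 2 +
        ∑ i ∈ Finset.Icc 1 n, d i * e i ^ 2 := by
  by_contra! hS
  set S := ∑ i ∈ Finset.range (n + 1), k i / a i ^ 2 * (u (i + 1) - u i) * g i ^ 2 +
        ∑ i ∈ Finset.Icc 1 n, d i * e i ^ 2 with hS_def
  obtain ⟨C, hC⟩ := exists_E_le_quadratic (d := d) hu ha hk heg hge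
  obtain ⟨B, hB⟩ := isBounded_iff_forall_norm_le.1 hbdd
  set R := max (max 1 (4 * C / -S)) (B + j + 1) with hR
  have hR1 : 1 ≤ R := (le_max_left _ _).trans (le_max_left _ _)
  have hRC : 4 * C / -S ≤ R := (le_max_right _ _).trans (le_max_left _ _)
  have hRB : B + j + 1 ≤ R := le_max_right _ _
  have hR0 : 0 < R := by linarith
  have he : Monotone e := monotone_nat_of_le_succ fun i => (heg i).trans (hge i)
  set x : EuclideanSpace ℝ (Fin n) :=
    WithLp.toLp 2 fun i : Fin n => ((i + 1 : ℕ) : ℝ) + e (i + 1) * R with hx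
  have hmem := hB x ⟨fun i i' hii => by
      have hlt : (i : ℕ) < i' := hii
      have h1 : ((i + 1 : ℕ) : ℝ) < ((i' + 1 : ℕ) : ℝ) := by exact_mod_cast Nat.succ_lt_succ hlt
      have h2 : e (i + 1) ≤ e (i' + 1) := he (by omega)
      simp only [hx]
      exact add_lt_add_of_lt_of_le h1 (mul_le_mul_of_nonneg_right h2 hR0.le), by
    rw [E_congr (η := fun i => i + e i * R)]
    · refine (hC R hR1).trans ?_
      rw [div_le_iff₀ (by linarith)] at hRC
      rw [← hS_def]
      nlinarith
    · intro i h1 h2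
      unfold toSeq
      rw [dif_pos (by omega)]
      simp only [hx]
      rw [Nat.sub_add_cancel h1]⟩
  have hcoord := (PiLp.norm_apply_le x ⟨j - 1, by omega⟩).trans hmem
  simp only [hx, Real.norm_eq_abs] at hcoord
  rw [Nat.sub_add_cancel hj] at hcoord
  have h1 := abs_sub_abs_le_abs_sub (e j * R) (-(j : ℝ))
  rw [abs_mul, hej, abs_neg, Nat.abs_cast, abs_of_pos hR0, sub_neg_eq_add,
    add_comm (e j * R)] at h1
  linarith

/-- The sub-level sets `Ω_c` are bounded for every `c ∈ ℝ` if and only if the coercivity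
conditions `S^j ≥ 0` and `S_j ≥ 0` hold for all `j = 1,…,n`. -/
theorem stmt5 (n : ℕ) (hn : 1 ≤ n) (u a k d : ℕ → ℝ)
    (hu : ∀ i ≤ n, u i < u (i + 1))
    (ha : ∀ i ≤ n, 0 < a i)
    (hk : ∀ i ≤ n, 0 < k i) :
    (∀ c : ℝ, Bornology.IsBounded {x : EuclideanSpace ℝ (Fin n) |
        (∀ i j : Fin n, i < j → x i < x j) ∧ E n u a k d (toSeq n x) ≤ c}) ↔
      ((∀ j, 1 ≤ j → j ≤ n →
          0 ≤ ∑ i ∈ Finset.Icc 1 j, (k (i - 1) / a (i - 1) ^ 2 * (u i - u (i - 1)) + d i)) ∧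
        (∀ j, 1 ≤ j → j ≤ n →
          0 ≤ ∑ i ∈ Finset.Icc j n, (k i / a i ^ 2 * (u (i + 1) - u i) + d i))) := by
  constructor
  · intro hbdd
    refine ⟨fun j hj hjn => ?_, fun j hj hjn => ?_⟩
    · have h := nonneg_of_isBounded_sublevel (e := fun i => if i ≤ j then -1 else 0)
        (g := fun i => if i + 1 ≤ j then -1 else 0) hu ha hk (hbdd 0)
        (fun i => by split_ifs <;> first | omega | norm_num) (fun i => le_rfl) hj hjn
        (by simp)
      have hfilter : Finset.Icc 1 j = (Finset.Icc 1 n).filter (· ≤ j) := by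
        ext i
        simp only [Finset.mem_Icc, Finset.mem_filter]
        omega
      refine h.trans_eq ?_
      rw [hfilter, Finset.sum_filter, ← sum_range_succ_ite_eq_sum_Icc,
        ← sum_range_succ_ite_eq_sum_Icc, ← Finset.sum_add_distrib]
      refine Finset.sum_congr rfl fun i _ => ?_
      simp only [Nat.add_sub_cancel]
      split_ifs <;> first | omega | ring
    · have h := nonneg_of_isBounded_sublevel (e := fun i => if j ≤ i then 1 else 0)
        (g := fun i => if j ≤ i then 1 else 0) hu ha hk (hbdd 0)
        (fun i => le_rfl) (fun i => by split_ifs <;> first | omega | norm_num) hj hjn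
        (by simp)
      have hfilter : Finset.Icc j n = (Finset.Icc 1 n).filter (j ≤ ·) := by
        ext i
        simp only [Finset.mem_Icc, Finset.mem_filter]
        omega
      refine h.trans_eq ?_
      rw [hfilter, Finset.sum_filter, ← sum_range_succ_ite_zero_eq_sum_Icc,
        ← sum_range_succ_ite_zero_eq_sum_Icc, ← Finset.sum_add_distrib]
      refine Finset.sum_congr rfl fun i _ => ?_
      split_ifs <;> first | omega | ring
  · rintro ⟨hS, hS'⟩ c
    exact isBounded_sublevel_of_coercive hn hu ha hk hS hS' c
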